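/- arXiv:2104.00710 — 2 statements merged into one kernel-verified Lean document; each statement's English description precedes it below -/
import Mathlib

section
/- The operator M on P commutes with every T_i: M T_i = T_i M for all 1 ≤ i ≤ N−1. -/
open Finset

noncomputable def phi (K : Type*) [Field K] (E : Finset ℕ) : Finset ℕ →₀ K :=
  Finsupp.single E 1

noncomputable def Tgen {K : Type*} [Field K] (t : K) (i : ℕ) :
    (Finset ℕ →₀ K) →ₗ[K] (Finset ℕ →₀ K) :=
  Finsupp.lift _ K _ fun E =>
    if i ∈ E then
      if i + 1 ∈ E then -(phi K E)
      else phi K (insert (i + 1) (E.erase i))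
    else
      if i + 1 ∈ E then t • phi K (insert i (E.erase (i + 1))) + (t - 1) • phi K E
      else t • phi K E

def sgn (i : ℕ) (E : Finset ℕ) : ℕ := (E.filter (· < i)).card

noncomputable def Mop (K : Type*) [Field K] (N : ℕ) :
    (Finset ℕ →₀ K) →ₗ[K] (Finset ℕ →₀ K) :=
  Finsupp.lift _ K _ fun E =>
    ∑ i ∈ (Finset.Icc 1 N) \ E, ((-1 : K) ^ sgn i E) • phi K (insert i E)

noncomputable def Dop {K : Type*} [Field K] (t : K) :
    (Finset ℕ →₀ K) →ₗ[K] (Finset ℕ →₀ K) :=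
  Finsupp.lift _ K _ fun E =>
    ∑ i ∈ E, ((-1 : K) ^ sgn i E * t ^ (i - 1)) • phi K (E.erase i)

noncomputable def qint {K : Type*} [Field K] (t : K) (n : ℕ) : K :=
  ∑ i ∈ Finset.range n, t ^ i

noncomputable def kappa {K : Type*} [Field K] (t : K) (n : ℤ) : K :=
  if 0 < n then t ^ n.toNat / qint t n.toNat else -(1 / qint t (-n).toNat)

section HeckeCommutation

variable {K : Type*} [Field K]

lemma Tgen_phi (t : K) (i : ℕ) (E : Finset ℕ) :
    Tgen t i (phi K E) =
      if i ∈ E then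
        if i + 1 ∈ E then -(phi K E)
        else phi K (insert (i + 1) (E.erase i))
      else
        if i + 1 ∈ E then t • phi K (insert i (E.erase (i + 1))) + (t - 1) • phi K E
        else t • phi K E := by
  rw [Tgen, Finsupp.lift_apply]
  refine (Finsupp.sum_single_index ?_).trans (one_smul K _)
  exact zero_smul K _

lemma Mop_phi (N : ℕ) (E : Finset ℕ) :
    Mop K N (phi K E) = ∑ i ∈ Icc 1 N \ E, ((-1 : K) ^ sgn i E) • phi K (insert i E) := by
  rw [Mop, Finsupp.lift_apply]
  refine (Finsupp.sum_single_index ?_).trans (one_smul K _)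
  exact zero_smul K _

section Tgen

variable (t : K) {i : ℕ} {F : Finset ℕ}

lemma Tgen_phi_of_notMem (hi : i ∉ F) (hi' : i + 1 ∉ F) :
    Tgen t i (phi K F) = t • phi K F := by
  simp [Tgen_phi, hi, hi']

lemma Tgen_phi_insert_left (hi : i ∉ F) (hi' : i + 1 ∉ F) :
    Tgen t i (phi K (insert i F)) = phi K (insert (i + 1) F) := by
  simp [Tgen_phi, hi, hi']

lemma Tgen_phi_insert_right (hi : i ∉ F) (hi' : i + 1 ∉ F) :
    Tgen t i (phi K (insert (i + 1) F)) =
      t • phi K (insert i F) + (t - 1) • phi K (insert (i + 1) F) := by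
  simp [Tgen_phi, hi, hi']

lemma Tgen_phi_insert_both (F : Finset ℕ) :
    Tgen t i (phi K (insert i (insert (i + 1) F))) = -phi K (insert i (insert (i + 1) F)) := by
  simp [Tgen_phi]

end Tgen

lemma sgn_insert (j k : ℕ) {F : Finset ℕ} (hk : k ∉ F) :
    sgn j (insert k F) = sgn j F + if k < j then 1 else 0 := by
  unfold sgn
  rw [filter_insert]
  split_ifs with h
  · rw [card_insert_of_notMem (by simp [hk])]
  · rfl

lemma sgn_succ_of_notMem {i : ℕ} {F : Finset ℕ} (hi : i ∉ F) : sgn (i + 1) F = sgn i F := by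
  unfold sgn
  congr 1
  ext x
  simp only [mem_filter, and_congr_right_iff]
  intro hx
  have : x ≠ i := fun h => hi (h ▸ hx)
  omega

section Mop

variable {N i : ℕ} {F : Finset ℕ}

lemma Mop_phi_of_notMem (hi1 : 1 ≤ i) (hiN : i + 1 ≤ N) (hi : i ∉ F) (hi' : i + 1 ∉ F) :
    Mop K N (phi K F) =
      (-1 : K) ^ sgn i F • phi K (insert i F) + ((-1 : K) ^ sgn i F • phi K (insert (i + 1) F) +
        ∑ j ∈ Icc 1 N \ insert i (insert (i + 1) F), (-1 : K) ^ sgn j F • phi K (insert j F)) := by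
  have h : Icc 1 N \ F =
      insert i (insert (i + 1) (Icc 1 N \ insert i (insert (i + 1) F))) := by
    ext x
    simp only [mem_sdiff, mem_Icc, mem_insert]
    grind
  rw [Mop_phi, h, sum_insert (by simp), sum_insert (by simp), sgn_succ_of_notMem hi]

lemma Mop_phi_insert_left (hiN : i + 1 ≤ N) (hi : i ∉ F) (hi' : i + 1 ∉ F) :
    Mop K N (phi K (insert i F)) =
      -((-1 : K) ^ sgn i F • phi K (insert i (insert (i + 1) F))) +
        ∑ j ∈ Icc 1 N \ insert i (insert (i + 1) F),
          (-1 : K) ^ sgn j (insert i F) • phi K (insert i (insert j F)) := by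
  have h : Icc 1 N \ insert i F =
      insert (i + 1) (Icc 1 N \ insert i (insert (i + 1) F)) := by
    ext x
    simp only [mem_sdiff, mem_Icc, mem_insert]
    grind
  rw [Mop_phi, h, sum_insert (by simp), sgn_insert _ _ hi, sgn_succ_of_notMem hi,
    Finset.insert_comm (i + 1) i]
  simp [pow_succ, Finset.insert_comm _ i]

lemma Mop_phi_insert_right (hi1 : 1 ≤ i) (hiN : i + 1 ≤ N) (hi : i ∉ F) (hi' : i + 1 ∉ F) :
    Mop K N (phi K (insert (i + 1) F)) =
      (-1 : K) ^ sgn i F • phi K (insert i (insert (i + 1) F)) +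
        ∑ j ∈ Icc 1 N \ insert i (insert (i + 1) F),
          (-1 : K) ^ sgn j (insert i F) • phi K (insert (i + 1) (insert j F)) := by
  have h : Icc 1 N \ insert (i + 1) F =
      insert i (Icc 1 N \ insert i (insert (i + 1) F)) := by
    ext x
    simp only [mem_sdiff, mem_Icc, mem_insert]
    grind
  rw [Mop_phi, h, sum_insert (by simp), sgn_insert _ _ hi', if_neg (by omega), add_zero]
  congr 1
  refine sum_congr rfl fun j hj => ?_
  simp only [mem_sdiff, mem_insert, not_or] at hj
  have hlt : i + 1 < j ↔ i < j := by omega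
  rw [sgn_insert _ _ hi', sgn_insert _ _ hi, Finset.insert_comm]
  simp only [hlt]

lemma Mop_phi_insert_both (N i : ℕ) (F : Finset ℕ) :
    Mop K N (phi K (insert i (insert (i + 1) F))) =
      ∑ j ∈ Icc 1 N \ insert i (insert (i + 1) F),
        (-1 : K) ^ sgn j (insert i (insert (i + 1) F)) •
          phi K (insert i (insert (i + 1) (insert j F))) := by
  rw [Mop_phi]
  refine sum_congr rfl fun j _ => ?_
  rw [Finset.insert_comm j i, Finset.insert_comm j (i + 1)]

end Mop

lemma map_sum_smul_phi_insert (f : (Finset ℕ →₀ K) →ₗ[K] (Finset ℕ →₀ K)) {i : ℕ}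
    {F S : Finset ℕ} {c : ℕ → K} {g : ℕ → Finset ℕ} {h : ℕ → Finset ℕ →₀ K}
    (hi : i ∉ F) (hi' : i + 1 ∉ F)
    (hf : ∀ j, i ∉ insert j F → i + 1 ∉ insert j F → f (phi K (g j)) = h j) :
    f (∑ j ∈ S \ insert i (insert (i + 1) F), c j • phi K (g j)) =
      ∑ j ∈ S \ insert i (insert (i + 1) F), c j • h j := by
  rw [map_sum]
  refine sum_congr rfl fun j hj => ?_
  simp only [mem_sdiff, mem_insert, not_or] at hj
  rw [map_smul, hf j] <;> grind

section Commute

variable (t : K) {N i : ℕ} {F : Finset ℕ}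

lemma Mop_Tgen_phi_of_notMem (hi1 : 1 ≤ i) (hiN : i + 1 ≤ N) (hi : i ∉ F) (hi' : i + 1 ∉ F) :
    Mop K N (Tgen t i (phi K F)) = Tgen t i (Mop K N (phi K F)) := by
  rw [Tgen_phi_of_notMem t hi hi', map_smul, Mop_phi_of_notMem hi1 hiN hi hi', map_add, map_add,
    map_smul, map_smul, Tgen_phi_insert_left t hi hi', Tgen_phi_insert_right t hi hi',
    map_sum_smul_phi_insert _ hi hi' fun j => Tgen_phi_of_notMem t]
  simp only [smul_comm _ t, ← smul_sum]
  module

lemma Mop_Tgen_phi_insert_left (hi1 : 1 ≤ i) (hiN : i + 1 ≤ N) (hi : i ∉ F) (hi' : i + 1 ∉ F) :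
    Mop K N (Tgen t i (phi K (insert i F))) = Tgen t i (Mop K N (phi K (insert i F))) := by
  rw [Tgen_phi_insert_left t hi hi', Mop_phi_insert_right hi1 hiN hi hi',
    Mop_phi_insert_left hiN hi hi', map_add, map_neg, map_smul, Tgen_phi_insert_both,
    map_sum_smul_phi_insert _ hi hi' fun j => Tgen_phi_insert_left t]
  module

lemma Mop_Tgen_phi_insert_right (hi1 : 1 ≤ i) (hiN : i + 1 ≤ N) (hi : i ∉ F) (hi' : i + 1 ∉ F) :
    Mop K N (Tgen t i (phi K (insert (i + 1) F))) =
      Tgen t i (Mop K N (phi K (insert (i + 1) F))) := by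
  rw [Tgen_phi_insert_right t hi hi', map_add, map_smul, map_smul,
    Mop_phi_insert_right hi1 hiN hi hi', Mop_phi_insert_left hiN hi hi', map_add, map_smul,
    Tgen_phi_insert_both, map_sum_smul_phi_insert _ hi hi' fun j => Tgen_phi_insert_right t]
  simp only [smul_add, sum_add_distrib, smul_comm _ t, smul_comm _ (t - 1), ← smul_sum]
  module

lemma Mop_Tgen_phi_insert_both (hi : i ∉ F) (hi' : i + 1 ∉ F) :
    Mop K N (Tgen t i (phi K (insert i (insert (i + 1) F)))) =
      Tgen t i (Mop K N (phi K (insert i (insert (i + 1) F)))) := by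
  rw [Tgen_phi_insert_both, map_neg, Mop_phi_insert_both,
    map_sum_smul_phi_insert _ hi hi' fun j _ _ => Tgen_phi_insert_both t (insert j F)]
  simp only [smul_neg, sum_neg_distrib]

end Commute

end HeckeCommutation

/-- The degree-raising operator `M` commutes with every Hecke generator `T_i`,
1 ≤ i ≤ N−1. -/
theorem M_commutes_with_T {K : Type*} [Field K] (t : K) (N : ℕ) (hN : 1 ≤ N)
    (i : ℕ) (hi1 : 1 ≤ i) (hiN : i ≤ N - 1) :
    (Mop K N) ∘ₗ (Tgen t i) = (Tgen t i) ∘ₗ (Mop K N) := by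
  refine Finsupp.lhom_ext' fun E => LinearMap.ext_ring ?_
  change Mop K N (Tgen t i (phi K E)) = Tgen t i (Mop K N (phi K E))
  have hiN' : i + 1 ≤ N := by omega
  by_cases h : i ∈ E <;> by_cases h' : i + 1 ∈ E
  · have hE : E = insert i (insert (i + 1) ((E.erase i).erase (i + 1))) := by
      rw [insert_erase (by simp [h']), insert_erase h]
    rw [hE]
    exact Mop_Tgen_phi_insert_both t (by simp) (by simp)
  · rw [← insert_erase h]
    exact Mop_Tgen_phi_insert_left t hi1 hiN' (by simp) (by simp [h'])
  · rw [← insert_erase h']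
    exact Mop_Tgen_phi_insert_right t hi1 hiN' (by simp [h]) (by simp)
  · exact Mop_Tgen_phi_of_notMem t hi1 hiN' h h'
end

section
/- Let N ≥ 2, 0 ≤ m ≤ N−2, and assume [n]_t ≠ 0 for 1 ≤ n ≤ m+1. For N−m−1 ≤ i ≤ N set π_i := φ_{{N−m−1,…,N}∖{i}} ∈ P. Then for every 1 ≤ j ≤ m+1, (T_{N−j} − κ_{m+2−j})(T_{N−j+1} − κ_{m+3−j})⋯(T_{N−1} − κ_{m+1}) π_N = π_{N−j} + (1/[m+2−j]_t) · Σ_{i=0}^{j−1} (−1)^{j−i} t^{m+1−i} π_{N−i}, where the operator product is composed so that the rightmost factor (T_{N−1} − κ_{m+1}) acts first. -/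
open Finset

theorem Tgen_phi_of_mem_of_mem {K : Type*} [Field K] (t : K) {i : ℕ} {E : Finset ℕ}
    (h : i ∈ E) (h' : i + 1 ∈ E) : Tgen t i (phi K E) = -phi K E := by
  simp [Tgen, phi, h, h']

theorem Tgen_phi_of_mem_of_notMem {K : Type*} [Field K] (t : K) {i : ℕ} {E : Finset ℕ}
    (h : i ∈ E) (h' : i + 1 ∉ E) :
    Tgen t i (phi K E) = phi K (insert (i + 1) (E.erase i)) := by
  simp [Tgen, phi, h, h']

theorem Tgen_phi_erase_succ {K : Type*} [Field K] (t : K) {i : ℕ} {E : Finset ℕ}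
    (h : i ∈ E) (h' : i + 1 ∈ E) :
    Tgen t i (phi K (E.erase (i + 1))) = phi K (E.erase i) := by
  rw [Tgen_phi_of_mem_of_notMem t (by simp [h]) (by simp), erase_right_comm,
    insert_erase (by simp [h'])]

theorem Tgen_phi_erase_of_ne {K : Type*} [Field K] (t : K) {i k : ℕ} {E : Finset ℕ}
    (h : i ∈ E) (h' : i + 1 ∈ E) (hk : i ≠ k) (hk' : i + 1 ≠ k) :
    Tgen t i (phi K (E.erase k)) = -phi K (E.erase k) :=
  Tgen_phi_of_mem_of_mem t (by simp [h, hk]) (by simp [h', hk'])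

theorem kappa_natCast {K : Type*} [Field K] (t : K) {n : ℕ} (hn : 0 < n) :
    kappa t (n : ℤ) = t ^ n / qint t n := by
  simp [kappa, hn]

theorem qint_succ {K : Type*} [Field K] (t : K) (n : ℕ) :
    qint t (n + 1) = qint t n + t ^ n := by
  simp [qint, sum_range_succ]

theorem neg_one_sub_kappa_div_qint_succ {K : Type*} [Field K] (t : K) {n : ℕ} (hn : 0 < n)
    (h : qint t n ≠ 0) (h' : qint t (n + 1) ≠ 0) :
    (-1 - kappa t (n : ℤ)) * (1 / qint t (n + 1)) = -(1 / qint t n) := by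
  rw [kappa_natCast t hn]
  field_simp
  rw [qint_succ]
  ring

/-- With `π_i = φ_{{N−m−1,…,N}∖{i}}`, for `1 ≤ j ≤ m+1` the product
`(T_{N−j} − κ_{m+2−j})⋯(T_{N−1} − κ_{m+1})` (rightmost factor acting first)
sends `π_N` to `π_{N−j} + (1/[m+2−j]_t)·Σ_{i=0}^{j−1} (−1)^{j−i} t^{m+1−i} π_{N−i}`. -/
theorem type0_partial_product_formula {K : Type*} [Field K] (t : K) (N m : ℕ)
    (hN : 2 ≤ N) (hm : m ≤ N - 2)
    (hreg : ∀ n : ℕ, 1 ≤ n → n ≤ m + 1 → qint t n ≠ 0)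
    (j : ℕ) (hj1 : 1 ≤ j) (hjm : j ≤ m + 1) :
    (((List.range j).map fun l =>
        (Tgen t (N - j + l) : Module.End K (Finset ℕ →₀ K))
          - kappa t ((m : ℤ) + 2 - j + l) • 1).prod)
      (phi K ((Finset.Icc (N - m - 1) N).erase N))
    = phi K ((Finset.Icc (N - m - 1) N).erase (N - j))
      + (1 / qint t (m + 2 - j)) •
          ∑ i ∈ Finset.range j,
            ((-1 : K) ^ (j - i) * t ^ (m + 1 - i)) •
              phi K ((Finset.Icc (N - m - 1) N).erase (N - i)) := by
  clear hj1
  induction j with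
  | zero => simp
  | succ j ih =>
    obtain ⟨n, hn⟩ : ∃ n, m + 1 = n + j := ⟨m + 1 - j, by omega⟩
    obtain ⟨a, ha⟩ : ∃ a, N = a + 1 + j := ⟨N - 1 - j, by omega⟩
    have hn0 : 0 < n := by omega
    have hshift : (fun l : ℕ => (Tgen t (N - (j + 1) + (l + 1)) : Module.End K (Finset ℕ →₀ K))
          - kappa t ((m : ℤ) + 2 - (j + 1 : ℕ) + (l + 1 : ℕ)) • 1) =
        fun l : ℕ => (Tgen t (N - j + l) : Module.End K (Finset ℕ →₀ K))
          - kappa t ((m : ℤ) + 2 - j + l) • 1 := by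
      funext l
      have h₁ : N - (j + 1) + (l + 1) = N - j + l := by omega
      have h₂ : (m : ℤ) + 2 - (j + 1 : ℕ) + (l + 1 : ℕ) = (m : ℤ) + 2 - j + l := by
        push_cast
        ring
      rw [h₁, h₂]
    have hκ : (m : ℤ) + 2 - (j + 1 : ℕ) + (0 : ℕ) = (n : ℤ) := by
      push_cast
      omega
    have hstart : N - (j + 1) + 0 = a := by omega
    have hstart' : N - (j + 1) = a := by omega
    have hj : N - j = a + 1 := by omega
    have hden : m + 2 - j = n + 1 := by omega
    have hden' : m + 2 - (j + 1) = n := by omega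
    have hexp : m + 1 - j = n := by omega
    have ha₀ : a ∈ Icc (N - m - 1) N := by
      rw [mem_Icc]
      omega
    have ha₁ : a + 1 ∈ Icc (N - m - 1) N := by
      rw [mem_Icc]
      omega
    rw [List.range_succ_eq_map, List.map_cons, List.prod_cons, List.map_map]
    simp only [Function.comp_def, Nat.succ_eq_add_one]
    rw [hshift, Module.End.mul_apply, ih (by omega), hκ, hstart, hstart', hj, hden, hden']
    set E := Icc (N - m - 1) N
    set S : Finset ℕ →₀ K := ∑ i ∈ range j, ((-1 : K) ^ (j - i) * t ^ (m + 1 - i)) •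
      phi K (E.erase (N - i)) with hS
    have hTS : Tgen t a S = -S := by
      rw [hS, map_sum, ← sum_neg_distrib]
      refine sum_congr rfl fun i hi => ?_
      rw [mem_range] at hi
      rw [map_smul, Tgen_phi_erase_of_ne t ha₀ ha₁ (by omega) (by omega), smul_neg]
    have hsum : ∑ i ∈ range (j + 1), ((-1 : K) ^ (j + 1 - i) * t ^ (m + 1 - i)) •
        phi K (E.erase (N - i)) = -S - t ^ n • phi K (E.erase (a + 1)) := by
      rw [sum_range_succ, hS, ← sum_neg_distrib, hj, hexp, Nat.add_sub_cancel_left, pow_one,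
        neg_one_mul, neg_smul, sub_eq_add_neg]
      congr 1
      refine sum_congr rfl fun i hi => ?_
      rw [mem_range] at hi
      rw [Nat.succ_sub hi.le, pow_succ, mul_neg_one, neg_mul, neg_smul]
    have hcoef : ((-1 - kappa t (n : ℤ)) * (1 / qint t (n + 1))) • S = -(1 / qint t n) • S := by
      rcases Nat.eq_zero_or_pos j with rfl | hjpos
      · simp [hS]
      · rw [neg_one_sub_kappa_div_qint_succ t hn0 (hreg n hn0 (by omega))
          (hreg (n + 1) (by omega) (by omega))]
    calc _ = phi K (E.erase a) - kappa t (n : ℤ) • phi K (E.erase (a + 1)) +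
          ((-1 - kappa t (n : ℤ)) * (1 / qint t (n + 1))) • S := by
          simp only [LinearMap.sub_apply, LinearMap.smul_apply, Module.End.one_apply, map_add,
            map_smul, hTS, Tgen_phi_erase_succ t ha₀ ha₁]
          module
      _ = _ := by
          rw [hcoef, hsum, kappa_natCast t hn0]
          module
end
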